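/- The splay algorithm satisfies the access lemma via the SOL potential: there is a constant C such that for every positive weight function w and every splay access (to element s in tree T with search path P, producing tree T'): |P| ≤ Φ_T − Φ_{T'} + C·(1 + log(W/w(s))). -/

import Mathlib

namespace Paper

inductive BTree where
  | nil : BTree
  | node : BTree → ℕ → BTree → BTree
deriving DecidableEq

namespace BTree

def keys : BTree → Finset ℕ
  | nil => ∅
  | node l x r => insert x (keys l ∪ keys r)

def root? : BTree → Option ℕ
  | nil => none
  | node _ x _ => some x

def isBST : BTree → Prop
  | nil => True
  | node l x r => (∀ y ∈ keys l, y < x) ∧ (∀ y ∈ keys r, x < y) ∧ isBST l ∧ isBST r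

def subtree? (s : ℕ) : BTree → Option BTree
  | nil => none
  | node l x r => if s = x then some (node l x r) else if s < x then subtree? s l else subtree? s r

/-- The set of keys of the subtree rooted at `s` (∅ if `s` is not in the tree). -/
def subtreeKeys (T : BTree) (s : ℕ) : Finset ℕ := ((subtree? s T).map keys).getD ∅

/-- The search path to `s`, listed from the root downwards. -/
def pathList (s : ℕ) : BTree → List ℕ
  | nil => []
  | node l x r => if s = x then [x] else if s < x then x :: pathList s l else x :: pathList s r

def pathSet (T : BTree) (s : ℕ) : Finset ℕ := (pathList s T).toFinset

def nodeDepth (s : ℕ) : BTree → ℕ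
  | nil => 0
  | node l x r => if s = x then 0 else if s < x then nodeDepth s l + 1 else nodeDepth s r + 1

/-- Number of right-going edges on the path from the root to `s`. -/
def rightDepth (s : ℕ) : BTree → ℕ
  | nil => 0
  | node l x r => if s = x then 0 else if s < x then rightDepth s l else rightDepth s r + 1

/-- Number of left-going edges on the path from the root to `s`. -/
def leftDepth (s : ℕ) : BTree → ℕ
  | nil => 0
  | node l x r => if s = x then 0 else if s < x then leftDepth s l + 1 else leftDepth s r

def leafCount : BTree → ℕ
  | nil => 0
  | node nil _ nil => 1
  | node l _ r => leafCount l + leafCount r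

/-- The wing partition of a BST, each wing listed from its topmost node downwards. -/
def wings : BTree → List (List ℕ)
  | nil => []
  | node l x r =>
    match wings l with
    | [] => [x] :: wings r
    | wl :: rest => (x :: wl) :: (rest ++ wings r)

end BTree

open BTree

/-- The left-leaning path on `[n]`: `n` at the root, `1` at the deepest node. -/
def leftPathTree : ℕ → BTree
  | 0 => BTree.nil
  | n + 1 => BTree.node (leftPathTree n) (n + 1) BTree.nil

/-- Number of side alternations (w.r.t. `s`) between adjacent elements of a list. -/
def sideAlt (s : ℕ) : List ℕ → ℕ
  | x :: y :: rest => (if (x < s ∧ s < y) ∨ (y < s ∧ s < x) then 1 else 0) + sideAlt s (y :: rest)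
  | _ => 0

/-- The set of elements involved in side alternations (w.r.t. `s`) in a list. -/
def zigzagSet (s : ℕ) : List ℕ → Finset ℕ
  | x :: y :: rest =>
    (if (x < s ∧ s < y) ∨ (y < s ∧ s < x) then ({x, y} : Finset ℕ) else ∅) ∪ zigzagSet s (y :: rest)
  | _ => ∅

noncomputable def wsum (w : ℕ → ℝ) (X : Finset ℕ) : ℝ := ∑ b ∈ X, w b

/-- Partial sum-of-logs potential of the set `X` in tree `T` (binary logarithm). -/
noncomputable def phiOn (w : ℕ → ℝ) (T : BTree) (X : Finset ℕ) : ℝ :=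
  ∑ a ∈ X, Real.logb 2 (wsum w (subtreeKeys T a))

noncomputable def phiAll (w : ℕ → ℝ) (T : BTree) : ℝ := phiOn w T (keys T)

/-- A single access of a minimally self-adjusting BST algorithm: the accessed element `s`
becomes the root, the keys are unchanged, and every node off the search path keeps its
subtree; hence the search path is replaced by an after-tree rooted at `s` and the pendent
subtrees are reattached in the unique order-preserving way. -/
structure IsAccess (T : BTree) (s : ℕ) (T' : BTree) : Prop where
  hT : isBST T
  hT' : isBST T'
  hs : s ∈ keys T
  hkeys : keys T' = keys T
  hroot : root? T' = some s
  hpendent : ∀ a ∈ keys T, a ∉ pathSet T s → subtree? a T' = subtree? a T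

/-- The algorithm (viewed as the set of accesses it may perform) satisfies the access lemma
via the sum-of-logs potential. -/
def SatisfiesAL (Alg : BTree → ℕ → BTree → Prop) : Prop :=
  ∃ C : ℝ, 0 ≤ C ∧ ∀ T s T', Alg T s T' → ∀ w : ℕ → ℝ, (∀ i ∈ keys T, 0 < w i) →
    ((pathSet T s).card : ℝ) ≤
      phiAll w T - phiAll w T' + C * (1 + Real.logb 2 (wsum w (keys T) / w s))

/-- `X` is subtree-disjoint (w.r.t. the tree after the access). -/
def SubtreeDisjoint (T' : BTree) (X : Finset ℕ) : Prop :=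
  ∀ a ∈ X, ∀ b ∈ X, a ≠ b → subtreeKeys T' a ∩ subtreeKeys T' b = ∅

/-- `X` is monotone: all elements on one side of `s`, with equal right-depth
(resp. left-depth) in the after-tree.  (For nodes of the search path, depth in the
after-tree coincides with depth in `T'`.) -/
def IsMonotone (s : ℕ) (T' : BTree) (X : Finset ℕ) : Prop :=
  ((∀ x ∈ X, s < x) ∧ ∃ d, ∀ x ∈ X, rightDepth x T' = d) ∨
  ((∀ x ∈ X, x < s) ∧ ∃ d, ∀ x ∈ X, leftDepth x T' = d)

/-- The after-tree minus its root can be partitioned into (at most) `k` monotone sets. -/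
def MonotoneDecomp (T : BTree) (s : ℕ) (T' : BTree) (k : ℕ) : Prop :=
  ∃ M : Fin k → Finset ℕ,
    (∀ i, IsMonotone s T' (M i)) ∧
    (∀ i j, i ≠ j → Disjoint (M i) (M j)) ∧
    Finset.univ.biUnion M = pathSet T s \ {s}

/-- The leaves of the after-tree: path nodes having no path node as proper descendant in `T'`. -/
def afterLeaves (T : BTree) (s : ℕ) (T' : BTree) : Finset ℕ :=
  (pathSet T s).filter (fun x => subtreeKeys T' x ∩ pathSet T s = {x})

/-- Rotate-to-root: `s` becomes the root and ancestor relations are otherwise preserved,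
equivalently `T'(a) = T(a) ∩ (-∞,s)` for path nodes `a < s` and symmetrically for `a > s`. -/
def IsRotateToRoot (T : BTree) (s : ℕ) (T' : BTree) : Prop :=
  subtreeKeys T' s = keys T ∧
  ∀ a ∈ pathSet T s,
    (a < s → subtreeKeys T' a = (subtreeKeys T a).filter (fun b => b < s)) ∧
    (s < a → subtreeKeys T' a = (subtreeKeys T a).filter (fun b => s < b))

def pendTree : Option ℕ → BTree
  | none => BTree.nil
  | some u => BTree.node BTree.nil u BTree.nil

def buildLeft (l : List (ℕ × Option ℕ)) : BTree :=
  l.foldl (fun t vc => BTree.node (pendTree vc.2) vc.1 t) BTree.nil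

def buildRight (l : List (ℕ × Option ℕ)) : BTree :=
  l.foldl (fun t vc => BTree.node t vc.1 (pendTree vc.2)) BTree.nil

/-- Global view of splay: process the reversed search path `v₁, v₂, …` in pairs; if a pair
lies on the same side of `s`, the more ancestral element is removed from its path and
becomes a (pendant) child of the other.  Returns the two spines (elements `< s` and `> s`),
deepest first, each spine node with its optional pendant child. -/
def splaySpines (s : ℕ) : List ℕ → List (ℕ × Option ℕ) × List (ℕ × Option ℕ)
  | [] => ([], [])
  | [v] => if v < s then ([(v, none)], []) else ([], [(v, none)])
  | v :: u :: rest =>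
    let p := splaySpines s rest
    if v < s then
      if u < s then ((v, some u) :: p.1, p.2)
      else ((v, none) :: p.1, (u, none) :: p.2)
    else
      if u < s then ((u, none) :: p.1, (v, none) :: p.2)
      else (p.1, (v, some u) :: p.2)

/-- The after-tree of a splay access, built from the reversed search path without `s`. -/
def splayAfterTree (s : ℕ) (l : List ℕ) : BTree :=
  BTree.node (buildLeft (splaySpines s l).1) s (buildRight (splaySpines s l).2)

/-- A splay access: a valid access whose after-tree (the restriction of `T'` to the search
path) is the splay after-tree. -/
def IsSplayAccess (T : BTree) (s : ℕ) (T' : BTree) : Prop :=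
  IsAccess T s T' ∧
  ∀ x ∈ pathSet T s,
    subtreeKeys T' x ∩ pathSet T s = subtreeKeys (splayAfterTree s (pathList s T).reverse.tail) x

/-- A path-balance access: a valid access whose after-tree is a balanced BST of depth
`⌈log₂ (1 + |P|)⌉` rooted at `s`. -/
def IsPathBalanceAccess (T : BTree) (s : ℕ) (T' : BTree) : Prop :=
  IsAccess T s T' ∧
  ∀ x ∈ pathSet T s, nodeDepth x T' ≤ Nat.clog 2 (1 + (pathSet T s).card)

def isParent (Q : BTree) (x y : ℕ) : Prop := pathList y Q = pathList x Q ++ [y]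

/-- One step of a decomposition: a (descending) path `Pi` of `Q` is rearranged into a tree,
all other nodes keeping their subtrees. -/
def StepRel (Q Q' : BTree) (Pi : Finset ℕ) : Prop :=
  isBST Q' ∧ keys Q' = keys Q ∧
  (∃ l : List ℕ, l ≠ [] ∧ List.Chain' (isParent Q) l ∧ l.toFinset = Pi) ∧
  (∀ a ∈ keys Q, a ∉ Pi → subtree? a Q' = subtree? a Q)

/-- The transformation of the before-path `P0` (as a tree) into the after-tree `A` admits a
local decomposition with window size `wdw`. -/
def HasLocalDecomp (s : ℕ) (P0 A : BTree) (wdw : ℕ) : Prop :=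
  ∃ (k : ℕ) (Q : ℕ → BTree) (Ps : ℕ → Finset ℕ),
    1 ≤ k ∧ Q 0 = P0 ∧ Q k = A ∧
    (∀ i < k, StepRel (Q i) (Q (i + 1)) (Ps i)) ∧
    s ∈ Ps 0 ∧
    (∀ i, i + 1 < k → (Ps (i + 1) \ Ps i).Nonempty) ∧
    (∀ i, i + 1 < k → (Ps (i + 1) ∩ Ps i).Nonempty) ∧
    (∀ i j, i + 1 < j → j < k → Disjoint (Ps i \ Ps (i + 1)) (Ps j)) ∧
    (∀ i < k, (Ps i).card ≤ wdw)

/-- The search path to `s` in `T`, as a tree (the before-path of the transformation). -/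
def pathTree (s : ℕ) : BTree → BTree
  | BTree.nil => BTree.nil
  | BTree.node l x r =>
    if s = x then BTree.node BTree.nil x BTree.nil
    else if s < x then BTree.node (pathTree s l) x BTree.nil
    else BTree.node BTree.nil x (pathTree s r)

/-- `A` is the after-tree of the access `(T, s, T')`: the restriction of `T'` to the search path. -/
def IsAfterTree (T : BTree) (s : ℕ) (T' A : BTree) : Prop :=
  isBST A ∧ keys A = pathSet T s ∧
  ∀ x ∈ pathSet T s, subtreeKeys A x = subtreeKeys T' x ∩ pathSet T s

/-- The algorithm is local with window size `wdw`. -/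
def IsLocal (Alg : BTree → ℕ → BTree → Prop) (wdw : ℕ) : Prop :=
  ∀ T s T', Alg T s T' → ∀ A, IsAfterTree T s T' A → HasLocalDecomp s (pathTree s T) A wdw

open scoped Classical in
noncomputable def stair (n : ℕ) (h : ℕ → ℕ) (s : ℕ) : Finset ℕ :=
  (Finset.Icc 1 n).filter
    (fun b => ∀ b' ∈ Finset.Icc 1 n, ((s < b' ∧ b' < b) ∨ (b < b' ∧ b' < s)) → h b' < h b)

open scoped Classical in
noncomputable def nbhd (n : ℕ) (h : ℕ → ℕ) (a : ℕ) : Finset ℕ :=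
  (Finset.Icc 1 n).filter
    (fun b => ∀ b' ∈ Finset.Icc 1 n, b' ≠ a → min a b ≤ b' → b' ≤ max a b → h b' < h a)

/-- Geometric sum-of-logs partial potential. -/
noncomputable def phiGeo (n : ℕ) (h : ℕ → ℕ) (w : ℕ → ℝ) (X : Finset ℕ) : ℝ :=
  ∑ a ∈ X, Real.logb 2 (wsum w (nbhd n h a))

/-- `l` is (the reversal of) a valid search path to `s`, without `s`, deepest element first. -/
def ValidRevPath (s : ℕ) (l : List ℕ) : Prop :=
  l.Nodup ∧ s ∉ l ∧
  l.Pairwise (fun a b => (a < s → b < s → b < a) ∧ (s < a → s < b → a < b))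

end Paper

open Paper Paper.BTree

namespace SplayAccess

/-- `b` and `s` lie strictly on the same side of `q`. -/
def SameSide (s q b : ℕ) : Prop := (s < q ∧ b < q) ∨ (q < s ∧ q < b)

open scoped Classical in
/-- The keys of `K` that no element of `l` separates from `s`. -/
noncomputable def unseparated (K : Finset ℕ) (s : ℕ) (l : List ℕ) : Finset ℕ :=
  K.filter (fun b => ∀ q ∈ l, SameSide s q b)

theorem mem_unseparated {K : Finset ℕ} {s b : ℕ} {l : List ℕ} :
    b ∈ unseparated K s l ↔ b ∈ K ∧ ∀ q ∈ l, SameSide s q b := by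
  simp [unseparated]

/-! ### Search trees -/

theorem pathList_subset_keys {s a : ℕ} : ∀ {T : BTree}, a ∈ pathList s T → a ∈ keys T
  | .nil, h => by simp [pathList] at h
  | .node l x r, h => by
    simp only [pathList] at h
    simp only [keys, Finset.mem_insert, Finset.mem_union]
    split_ifs at h
    · left; simpa using h
    · rcases List.mem_cons.1 h with h | h
      · exact Or.inl h
      · exact Or.inr (Or.inl (pathList_subset_keys h))
    · rcases List.mem_cons.1 h with h | h
      · exact Or.inl h
      · exact Or.inr (Or.inr (pathList_subset_keys h))

theorem exists_pathList_eq_append {s : ℕ} :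
    ∀ {T : BTree}, isBST T → s ∈ keys T → ∃ l, pathList s T = l ++ [s]
  | .nil, _, h => by simp [keys] at h
  | .node l x r, hT, h => by
    obtain ⟨hl, hr, hTl, hTr⟩ := hT
    simp only [keys, Finset.mem_insert, Finset.mem_union] at h
    simp only [pathList]
    split_ifs with h1 h2
    · exact ⟨[], by simp [h1]⟩
    · have : s ∈ keys l := by
        rcases h with h | h | h
        · omega
        · exact h
        · have := hr s h; omega
      obtain ⟨l', e⟩ := exists_pathList_eq_append hTl this
      exact ⟨x :: l', by simp [e]⟩
    · have : s ∈ keys r := by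
        rcases h with h | h | h
        · omega
        · have := hl s h; omega
        · exact h
      obtain ⟨l', e⟩ := exists_pathList_eq_append hTr this
      exact ⟨x :: l', by simp [e]⟩

theorem pairwise_pathList {s : ℕ} :
    ∀ {T : BTree}, isBST T → (pathList s T).Pairwise (fun q a => SameSide s q a)
  | .nil, _ => by simp [pathList]
  | .node l x r, hT => by
    obtain ⟨hl, hr, hTl, hTr⟩ := hT
    simp only [pathList]
    split_ifs with h1 h2
    · simp
    · exact List.pairwise_cons.2
        ⟨fun a ha => Or.inl ⟨h2, hl a (pathList_subset_keys ha)⟩, pairwise_pathList hTl⟩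
    · exact List.pairwise_cons.2
        ⟨fun a ha => Or.inr ⟨by omega, hr a (pathList_subset_keys ha)⟩, pairwise_pathList hTr⟩

theorem subtreeKeys_eq_unseparated {s p : ℕ} {pre post : List ℕ} :
    ∀ {T : BTree}, isBST T → pathList s T = pre ++ p :: post →
      subtreeKeys T p = unseparated (keys T) s pre
  | .nil, _, h => by simp [pathList] at h
  | .node l x r, hT, h => by
    obtain ⟨hl, hr, hTl, hTr⟩ := hT
    simp only [pathList] at h
    cases pre with
    | nil =>
      have hp : p = x := by
        split_ifs at h <;> simp at h <;> simp_all
      subst hp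
      ext b
      simp [subtreeKeys, subtree?, mem_unseparated]
    | cons y pre' =>
      split_ifs at h with h1 h2
      · simp at h
      · simp only [List.cons_append, List.cons.injEq] at h
        obtain ⟨rfl, h⟩ := h
        have hp : p < x := hl p (pathList_subset_keys (s := s) (by simp [h]))
        have ih := subtreeKeys_eq_unseparated hTl h
        have e : subtreeKeys (.node l x r) p = subtreeKeys l p := by
          simp [subtreeKeys, subtree?, hp, hp.ne]
        rw [e, ih]
        ext b
        simp only [mem_unseparated, keys, Finset.mem_insert, Finset.mem_union, List.mem_cons,
          forall_eq_or_imp]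
        constructor
        · rintro ⟨hb, hq⟩
          exact ⟨Or.inr (Or.inl hb), Or.inl ⟨h2, hl b hb⟩, hq⟩
        · rintro ⟨hb, hx, hq⟩
          refine ⟨?_, hq⟩
          simp only [SameSide] at hx
          rcases hb with hb | hb | hb
          · omega
          · exact hb
          · have := hr b hb; omega
      · simp only [List.cons_append, List.cons.injEq] at h
        obtain ⟨rfl, h⟩ := h
        have hp : x < p := hr p (pathList_subset_keys (s := s) (by simp [h]))
        have ih := subtreeKeys_eq_unseparated hTr h
        have e : subtreeKeys (.node l x r) p = subtreeKeys r p := by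
          simp [subtreeKeys, subtree?, hp.ne', hp.not_gt]
        rw [e, ih]
        ext b
        simp only [mem_unseparated, keys, Finset.mem_insert, Finset.mem_union, List.mem_cons,
          forall_eq_or_imp]
        constructor
        · rintro ⟨hb, hq⟩
          exact ⟨Or.inr (Or.inr hb), Or.inr ⟨by omega, hr b hb⟩, hq⟩
        · rintro ⟨hb, hx, hq⟩
          refine ⟨?_, hq⟩
          simp only [SameSide] at hx
          rcases hb with hb | hb | hb
          · omega
          · have := hl b hb; omega
          · exact hb

theorem subtreeKeys_subset {a : ℕ} : ∀ T : BTree, subtreeKeys T a ⊆ keys T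
  | .nil => by simp [subtreeKeys, subtree?]
  | .node l x r => by
    have hl := subtreeKeys_subset (a := a) l
    have hr := subtreeKeys_subset (a := a) r
    simp only [subtreeKeys, subtree?] at hl hr ⊢
    split_ifs
    · simp
    · intro b hb; simp [keys, hl hb]
    · intro b hb; simp [keys, hr hb]

theorem mem_subtreeKeys_self {a : ℕ} :
    ∀ {T : BTree}, isBST T → a ∈ keys T → a ∈ subtreeKeys T a
  | .nil, _, h => by simp [keys] at h
  | .node l x r, hT, h => by
    obtain ⟨hl, hr, hTl, hTr⟩ := hT
    have h' := h
    simp only [keys, Finset.mem_insert, Finset.mem_union] at h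
    simp only [subtreeKeys, subtree?]
    split_ifs with h1 h2
    · simpa using h'
    · rcases h with h | h | h
      · omega
      · exact mem_subtreeKeys_self hTl h
      · have := hr a h; omega
    · rcases h with h | h | h
      · omega
      · have := hl a h; omega
      · exact mem_subtreeKeys_self hTr h

theorem subtreeKeys_convex {a b c d : ℕ} :
    ∀ {T : BTree}, isBST T → b ∈ subtreeKeys T a → d ∈ subtreeKeys T a → c ∈ keys T →
      b ≤ c → c ≤ d → c ∈ subtreeKeys T a
  | .nil, _, h, _, _, _, _ => by simp [subtreeKeys, subtree?] at h
  | .node l x r, hT, hb, hd, hc, hbc, hcd => by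
    obtain ⟨hl, hr, hTl, hTr⟩ := hT
    have hc' := hc
    simp only [keys, Finset.mem_insert, Finset.mem_union] at hc
    simp only [subtreeKeys, subtree?] at hb hd ⊢
    split_ifs at hb hd ⊢ with h1 h2
    · simpa using hc'
    · have := hl d (subtreeKeys_subset l hd)
      rcases hc with hc | hc | hc
      · omega
      · exact subtreeKeys_convex hTl hb hd hc hbc hcd
      · have := hr c hc; omega
    · have := hr b (subtreeKeys_subset r hb)
      rcases hc with hc | hc | hc
      · omega
      · have := hl c hc; omega
      · exact subtreeKeys_convex hTr hb hd hc hbc hcd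

/-! ### The splay after-tree -/

/-- The union of the key sets of all subtrees with root `a`, wherever they occur. -/
def descendants (a : ℕ) : BTree → Finset ℕ
  | .nil => ∅
  | .node l x r =>
    (if a = x then keys (.node l x r) else ∅) ∪ (descendants a l ∪ descendants a r)

theorem subtreeKeys_subset_descendants {a : ℕ} :
    ∀ T : BTree, subtreeKeys T a ⊆ descendants a T
  | .nil => by simp [subtreeKeys, subtree?]
  | .node l x r => by
    have hl := subtreeKeys_subset_descendants (a := a) l
    have hr := subtreeKeys_subset_descendants (a := a) r
    simp only [subtreeKeys, subtree?, descendants] at hl hr ⊢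
    split_ifs
    · exact Finset.subset_union_left
    · intro b hb; simp [hl hb]
    · intro b hb; simp [hr hb]

theorem descendants_eq_empty {a : ℕ} : ∀ {T : BTree}, a ∉ keys T → descendants a T = ∅
  | .nil, _ => rfl
  | .node l x r, h => by
    simp only [keys, Finset.mem_insert, Finset.mem_union, not_or] at h
    simp [descendants, h.1, descendants_eq_empty h.2.1, descendants_eq_empty h.2.2]

theorem keys_pendTree (o : Option ℕ) (a : ℕ) : a ∈ keys (pendTree o) ↔ o = some a := by
  cases o <;> simp [pendTree, keys, eq_comm]

theorem descendants_foldl_left {a : ℕ} (l : List (ℕ × Option ℕ)) (t : BTree)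
    (h : ∀ p ∈ l, p.1 ≠ a ∧ p.2 ≠ some a) :
    descendants a (l.foldl (fun t vc => BTree.node (pendTree vc.2) vc.1 t) t)
      = descendants a t := by
  induction l generalizing t with
  | nil => rfl
  | cons p l ih =>
    obtain ⟨h1, h2⟩ := h p (by simp)
    rw [List.foldl_cons, ih _ fun q hq => h q (by simp [hq])]
    simp [descendants, h1.symm, descendants_eq_empty (mt (keys_pendTree _ _).1 h2)]

theorem descendants_foldl_right {a : ℕ} (l : List (ℕ × Option ℕ)) (t : BTree)
    (h : ∀ p ∈ l, p.1 ≠ a ∧ p.2 ≠ some a) :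
    descendants a (l.foldl (fun t vc => BTree.node t vc.1 (pendTree vc.2)) t)
      = descendants a t := by
  induction l generalizing t with
  | nil => rfl
  | cons p l ih =>
    obtain ⟨h1, h2⟩ := h p (by simp)
    rw [List.foldl_cons, ih _ fun q hq => h q (by simp [hq])]
    simp [descendants, h1.symm, descendants_eq_empty (mt (keys_pendTree _ _).1 h2)]

theorem splaySpines_mem (s : ℕ) (l : List ℕ) (p : ℕ × Option ℕ)
    (hp : p ∈ (splaySpines s l).1 ∨ p ∈ (splaySpines s l).2) :
    p.1 ∈ l ∧ ∀ u, p.2 = some u → u ∈ l := by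
  induction l using List.twoStepInduction with
  | nil => simp [splaySpines] at hp
  | singleton v =>
    simp only [splaySpines] at hp
    split_ifs at hp <;> simp at hp <;> simp [hp]
  | cons_cons v u rest ih _ =>
    have key : p.1 ∈ rest ∧ (∀ u, p.2 = some u → u ∈ rest) →
        p.1 ∈ v :: u :: rest ∧ ∀ w, p.2 = some w → w ∈ v :: u :: rest := by
      rintro ⟨h1, h2⟩
      exact ⟨by simp [h1], fun w hw => by simp [h2 w hw]⟩
    simp only [splaySpines] at hp
    split_ifs at hp <;> simp only [List.mem_cons] at hp <;>
      grind

/-- The properties of the subtrees `F a` of the after-tree that the amortized analysis uses: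
for each pair of the reversed search path, no later node and not `s` lies below it, and in the
zig-zig case the first node of the pair is not below the second. -/
def PairsSplit (s : ℕ) (F : ℕ → Finset ℕ) : List ℕ → Prop
  | v :: u :: rest =>
    (∀ q ∈ rest, q ∉ F v ∧ q ∉ F u) ∧ s ∉ F v ∧ s ∉ F u ∧ ((v < s ↔ u < s) → v ∉ F u) ∧
      PairsSplit s F rest
  | _ => True

theorem PairsSplit.mono {s : ℕ} {F G : ℕ → Finset ℕ} (P : Finset ℕ) (hs : s ∈ P)
    (hFG : ∀ a ∈ P, F a ∩ P ⊆ G a) (l : List ℕ) (hl : ∀ a ∈ l, a ∈ P)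
    (h : PairsSplit s G l) : PairsSplit s F l := by
  have key : ∀ a ∈ P, ∀ b ∈ P, b ∉ G a → b ∉ F a := fun a ha b hb hG hF =>
    hG (hFG a ha (Finset.mem_inter.2 ⟨hF, hb⟩))
  induction l using List.twoStepInduction with
  | nil => trivial
  | singleton v => trivial
  | cons_cons v u rest ih _ =>
    obtain ⟨h1, h2, h3, h4, h5⟩ := h
    have hv := hl v (by simp)
    have hu := hl u (by simp)
    have hr : ∀ a ∈ rest, a ∈ P := fun a ha => hl a (by simp [ha])
    exact ⟨fun q hq => ⟨key v hv q (hr q hq) (h1 q hq).1, key u hu q (hr q hq) (h1 q hq).2⟩,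
      key v hv s hs h2, key u hu s hs h3, fun h => key u hu v hv (h4 h), ih hr h5⟩

theorem pairsSplit_descendants (s : ℕ) (l : List ℕ) (hl : l.Nodup) (hs : s ∉ l) (L R : BTree)
    (hL : ∀ a ∈ keys L, a ∉ l ∧ a ≠ s) (hR : ∀ a ∈ keys R, a ∉ l ∧ a ≠ s) :
    PairsSplit s (fun a => descendants a (BTree.node
      ((splaySpines s l).1.foldl (fun t vc => BTree.node (pendTree vc.2) vc.1 t) L) s
      ((splaySpines s l).2.foldl (fun t vc => BTree.node t vc.1 (pendTree vc.2)) R))) l := by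
  induction l using List.twoStepInduction generalizing L R with
  | nil => trivial
  | singleton v => trivial
  | cons_cons v u rest ih _ =>
    simp only [List.nodup_cons, List.mem_cons, not_or] at hl hs hL hR
    obtain ⟨⟨hvu, hvr⟩, hur, hnd⟩ := hl
    obtain ⟨hsv, hsu, hsr⟩ := hs
    have hvL : v ∉ keys L := fun h => (hL v h).1.1 rfl
    have huL : u ∉ keys L := fun h => (hL u h).1.2.1 rfl
    have hvR : v ∉ keys R := fun h => (hR v h).1.1 rfl
    have huR : u ∉ keys R := fun h => (hR u h).1.2.1 rfl
    have step : ∀ L' R' : BTree, (∀ a ∈ keys L', a ∉ rest ∧ a ≠ s) →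
        (∀ a ∈ keys R', a ∉ rest ∧ a ≠ s) →
        ((v < s ↔ u < s) → v ∉ descendants u L' ∪ descendants u R') →
        descendants v L' ∪ descendants v R' ⊆ keys L' ∪ keys R' →
        descendants u L' ∪ descendants u R' ⊆ keys L' ∪ keys R' →
        PairsSplit s (fun a => descendants a (BTree.node
          ((splaySpines s rest).1.foldl (fun t vc => BTree.node (pendTree vc.2) vc.1 t) L') s
          ((splaySpines s rest).2.foldl (fun t vc => BTree.node t vc.1 (pendTree vc.2)) R')))
          (v :: u :: rest) := by
      intro L' R' hL' hR' huv hv hu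
      have e : ∀ a, a ∉ rest → s ≠ a → descendants a (BTree.node
          ((splaySpines s rest).1.foldl (fun t vc => BTree.node (pendTree vc.2) vc.1 t) L') s
          ((splaySpines s rest).2.foldl (fun t vc => BTree.node t vc.1 (pendTree vc.2)) R'))
          = descendants a L' ∪ descendants a R' := by
        intro a ha has
        have hm : ∀ p, p ∈ (splaySpines s rest).1 ∨ p ∈ (splaySpines s rest).2 →
            p.1 ≠ a ∧ p.2 ≠ some a := fun p hp =>
          ⟨fun h => ha (h ▸ (splaySpines_mem s rest p hp).1),
            fun h => ha ((splaySpines_mem s rest p hp).2 a h)⟩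
        rw [descendants, if_neg has.symm,
          descendants_foldl_left _ _ fun p hp => hm p (Or.inl hp),
          descendants_foldl_right _ _ fun p hp => hm p (Or.inr hp), Finset.empty_union]
      have hbad : ∀ b, b ∈ rest ∨ b = s → b ∉ keys L' ∪ keys R' := by
        intro b hb hk
        rcases Finset.mem_union.1 hk with hk | hk
        · have := hL' b hk; tauto
        · have := hR' b hk; tauto
      refine ⟨fun q hq => ⟨?_, ?_⟩, ?_, ?_, ?_, ih hnd hsr L' R' hL' hR'⟩
      · simp only [e v hvr hsv]; exact fun h => hbad q (Or.inl hq) (hv h)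
      · simp only [e u hur hsu]; exact fun h => hbad q (Or.inl hq) (hu h)
      · simp only [e v hvr hsv]; exact fun h => hbad s (Or.inr rfl) (hv h)
      · simp only [e u hur hsu]; exact fun h => hbad s (Or.inr rfl) (hu h)
      · simp only [e u hur hsu]; exact huv
    have dL := fun a (h : a ∉ keys L) => descendants_eq_empty h
    have dR := fun a (h : a ∉ keys R) => descendants_eq_empty h
    have hvu' : u ≠ v := fun h => hvu h.symm
    simp only [splaySpines]
    split_ifs with h1 h2 h2 <;> simp only [List.foldl_cons] <;> apply step <;>
      (try simp only [keys, pendTree, descendants, dL v hvL, dL u huL, dR v hvR, dR u huR, hvu,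
        hvu', if_true, if_false]) <;> grind

/-! ### The amortized analysis -/

theorem logb_add_logb_le {x y z : ℝ} (hx : 0 < x) (hy : 0 < y) (h : x + y ≤ z) :
    Real.logb 2 x + Real.logb 2 y + 2 ≤ 2 * Real.logb 2 z := by
  have h4 : Real.logb 2 4 = 2 := by
    rw [show (4 : ℝ) = 2 ^ (2 : ℕ) by norm_num, Real.logb_pow, Real.logb_self_eq_one] <;> norm_num
  have e1 : Real.logb 2 (x * y * 4) = Real.logb 2 x + Real.logb 2 y + 2 := by
    rw [Real.logb_mul (by positivity) (by norm_num), Real.logb_mul hx.ne' hy.ne', h4]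
  have e2 : Real.logb 2 (z ^ 2) = 2 * Real.logb 2 z := by
    rw [Real.logb_pow]; norm_num
  rw [← e1, ← e2]
  apply Real.logb_le_logb_of_le (by norm_num) (by positivity)
  nlinarith [sq_nonneg (x - y)]

section Weights

variable {w : ℕ → ℝ} {K X Y Z : Finset ℕ}

theorem wsum_pos (hw : ∀ i ∈ K, 0 < w i) (hX : X ⊆ K) (hne : X.Nonempty) : 0 < wsum w X :=
  Finset.sum_pos (fun i hi => hw i (hX hi)) hne

theorem wsum_mono (hw : ∀ i ∈ K, 0 < w i) (hXY : X ⊆ Y) (hY : Y ⊆ K) : wsum w X ≤ wsum w Y :=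
  Finset.sum_le_sum_of_subset_of_nonneg hXY fun i hi _ => (hw i (hY hi)).le

theorem logb_wsum_mono (hw : ∀ i ∈ K, 0 < w i) (hXY : X ⊆ Y) (hY : Y ⊆ K) (hne : X.Nonempty) :
    Real.logb 2 (wsum w X) ≤ Real.logb 2 (wsum w Y) :=
  Real.logb_le_logb_of_le (by norm_num) (wsum_pos hw (hXY.trans hY) hne) (wsum_mono hw hXY hY)

theorem logb_wsum_add_le (hw : ∀ i ∈ K, 0 < w i) (hX : X.Nonempty) (hY : Y.Nonempty)
    (hXZ : X ⊆ Z) (hYZ : Y ⊆ Z) (hZ : Z ⊆ K) (hd : Disjoint X Y) :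
    Real.logb 2 (wsum w X) + Real.logb 2 (wsum w Y) + 2 ≤ 2 * Real.logb 2 (wsum w Z) := by
  refine logb_add_logb_le (wsum_pos hw (hXZ.trans hZ) hX) (wsum_pos hw (hYZ.trans hZ) hY) ?_
  have : wsum w X + wsum w Y = wsum w (X ∪ Y) := (Finset.sum_union hd).symm
  rw [this]
  exact wsum_mono hw (Finset.union_subset hXZ hYZ) hZ

end Weights

theorem potential_bound {w : ℕ → ℝ} {K : Finset ℕ} (hw : ∀ i ∈ K, 0 < w i) {s : ℕ} (hs : s ∈ K)
    {F B : ℕ → Finset ℕ} (hFK : ∀ a ∈ K, F a ⊆ K) (hself : ∀ a ∈ K, a ∈ F a)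
    (hconv : ∀ a b c d, b ∈ F a → d ∈ F a → c ∈ K → b ≤ c → c ≤ d → c ∈ F a)
    (l : List ℕ) (hl : ∀ a ∈ l, a ∈ K ∧ a ≠ s) (hpw : l.Pairwise (fun a q => SameSide s q a))
    (hB : ∀ p post, p :: post <:+ l → B p = unseparated K s post) (hF : PairsSplit s F l) :
    (l.length : ℝ) + (l.map fun a => Real.logb 2 (wsum w (F a))).sum ≤
      (l.map fun a => Real.logb 2 (wsum w (B a))).sum + 1 +
        2 * (Real.logb 2 (wsum w K) - Real.logb 2 (wsum w (unseparated K s l))) := by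
  have sub : ∀ l', unseparated K s l' ⊆ K := fun l' b hb => (mem_unseparated.1 hb).1
  have anti : ∀ a l', unseparated K s (a :: l') ⊆ unseparated K s l' := fun a l' b hb =>
    mem_unseparated.2 ⟨(mem_unseparated.1 hb).1,
      fun q hq => (mem_unseparated.1 hb).2 q (List.mem_cons_of_mem _ hq)⟩
  have smem : ∀ l' : List ℕ, (∀ a ∈ l', a ∈ K ∧ a ≠ s) → s ∈ unseparated K s l' := by
    intro l' h
    refine mem_unseparated.2 ⟨hs, fun q hq => ?_⟩
    have := (h q hq).2
    simp only [SameSide]; omega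
  induction l using List.twoStepInduction with
  | nil =>
    have : unseparated K s [] = K := by ext; simp [mem_unseparated]
    simp [this]
  | singleton v =>
    have hvK := (hl v (by simp)).1
    have e : unseparated K s [] = K := by ext; simp [mem_unseparated]
    have h1 := logb_wsum_mono hw (hFK v hvK) subset_rfl ⟨v, hself v hvK⟩
    have h2 := logb_wsum_mono hw (sub [v]) subset_rfl ⟨s, smem [v] hl⟩
    simp only [List.length_singleton, List.map_cons, List.map_nil, List.sum_cons, List.sum_nil,
      hB v [] (List.suffix_refl _), e]
    push_cast
    linarith
  | cons_cons v u rest ih _ =>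
    obtain ⟨hq, hsv, hsu, hzz, hrest⟩ := hF
    obtain ⟨hvK, hvs⟩ := hl v (by simp)
    obtain ⟨huK, hus⟩ := hl u (by simp)
    have hlr : ∀ a ∈ rest, a ∈ K ∧ a ≠ s := fun a ha => hl a (by simp [ha])
    have hlu : ∀ a ∈ u :: rest, a ∈ K ∧ a ≠ s := fun a ha => hl a (List.mem_cons_of_mem _ ha)
    simp only [List.pairwise_cons, List.mem_cons, forall_eq_or_imp] at hpw
    obtain ⟨⟨hvu, hvr⟩, hur, hpr⟩ := hpw
    have IH := ih hlr hpr
      (fun p post h => hB p post (h.trans ⟨[v, u], rfl⟩)) hrest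
    have eu : B u = unseparated K s rest := hB u rest ⟨[v], rfl⟩
    have ev : B v = unseparated K s (u :: rest) := hB v _ (List.suffix_refl _)
    have conf : ∀ a ∈ K, (∀ q ∈ rest, q ∉ F a) → (∀ q ∈ rest, SameSide s q a) →
        F a ⊆ unseparated K s rest := by
      intro a ha h1 h2 b hb
      refine mem_unseparated.2 ⟨hFK a ha hb, fun q hq => ?_⟩
      have n1 := h1 q hq
      have n2 := h2 q hq
      have hqK := (hlr q hq).1
      have c1 := hconv a a q b (hself a ha) hb hqK
      have c2 := hconv a b q a hb (hself a ha) hqK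
      simp only [SameSide] at n2 ⊢
      by_contra hcon
      rcases n2 with n2 | n2
      · exact n1 (c1 (by omega) (by omega))
      · exact n1 (c2 (by omega) (by omega))
    have cv := conf v hvK (fun q h => (hq q h).1) hvr
    have cu := conf u huK (fun q h => (hq q h).2) hur
    have nv : (F v).Nonempty := ⟨v, hself v hvK⟩
    have nu : (F u).Nonempty := ⟨u, hself u huK⟩
    have n0 : (unseparated K s (v :: u :: rest)).Nonempty := ⟨s, smem _ hl⟩
    have m1 := logb_wsum_mono hw (anti v (u :: rest)) (sub _) n0
    have m2 := logb_wsum_mono hw (anti u rest) (sub _) ⟨s, smem _ hlu⟩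
    have m3 := logb_wsum_mono hw cv (sub _) nv
    simp only [List.length_cons, List.map_cons, List.sum_cons, eu, ev]
    push_cast
    by_cases hside : v < s ↔ u < s
    · have hd : Disjoint (F u) (unseparated K s (v :: u :: rest)) := by
        rw [Finset.disjoint_left]
        intro b hb hb'
        have hbv := (mem_unseparated.1 hb').2 v (by simp)
        have c1 := hconv u u v b (hself u huK) hb hvK
        have c2 := hconv u b v u hb (hself u huK) hvK
        have hn := hzz hside
        simp only [SameSide] at hbv hvu
        rcases hbv with hbv | hbv
        · exact hn (c2 (by omega) (by omega))
        · exact hn (c1 (by omega) (by omega))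
      have m4 := logb_wsum_add_le hw nu n0 cu ((anti v _).trans (anti u _)) (sub _) hd
      linarith
    · have hd : Disjoint (F v) (F u) := by
        rw [Finset.disjoint_left]
        intro b hb hb'
        have c1 := hconv v v s b (hself v hvK) hb hs
        have c2 := hconv v b s v hb (hself v hvK) hs
        have c3 := hconv u u s b (hself u huK) hb' hs
        have c4 := hconv u b s u hb' (hself u huK) hs
        rcases le_total b s with h | h
        · by_cases hv : v < s
          · exact hsu (c4 h (by omega))
          · exact hsv (c2 h (by omega))
        · by_cases hv : v < s
          · exact hsv (c1 hv.le h)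
          · exact hsu (c3 (by omega) h)
      have m4 := logb_wsum_add_le hw nv nu cv cu (sub _) hd
      linarith

end SplayAccess

open SplayAccess in
/-- **Theorem.** Splay satisfies the access lemma via the SOL potential. -/
theorem splay_access_lemma :
    ∃ C : ℝ, 0 ≤ C ∧ ∀ T s T', IsSplayAccess T s T' →
      ∀ w : ℕ → ℝ, (∀ i ∈ keys T, 0 < w i) →
        ((pathSet T s).card : ℝ) ≤
          phiAll w T - phiAll w T' + C * (1 + Real.logb 2 (wsum w (keys T) / w s)) := by
  refine ⟨3, by norm_num, ?_⟩
  rintro T s T' ⟨⟨hT, hT', hs, hkeys, -, hpend⟩, hafter⟩ w hw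
  obtain ⟨l', hl'⟩ := exists_pathList_eq_append hT hs
  obtain ⟨l, rfl⟩ : ∃ l : List ℕ, l' = l.reverse := ⟨l'.reverse, by simp⟩
  have hrev : (pathList s T).reverse = s :: l := by simp [hl']
  have hpw : (s :: l).Pairwise (fun a q => SameSide s q a) := by
    rw [← hrev, List.pairwise_reverse]; exact pairwise_pathList hT
  have hnd : (s :: l).Nodup := by
    refine hpw.imp fun {a q} h e => ?_
    subst e
    simp only [SameSide] at h
    omega
  have hP : pathSet T s = (s :: l).toFinset := by
    rw [← hrev, List.toFinset_reverse]; rfl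
  have hPK : pathSet T s ⊆ keys T := fun a ha => pathList_subset_keys (List.mem_toFinset.1 ha)
  have hlP : ∀ a ∈ s :: l, a ∈ pathSet T s := fun a ha => by rw [hP]; exact List.mem_toFinset.2 ha
  have hsl : s ∉ l := (List.nodup_cons.1 hnd).1
  have hsuffix : ∀ p post, p :: post <:+ s :: l →
      subtreeKeys T p = unseparated (keys T) s post := by
    rintro p post ⟨pre, hpre⟩
    have : pathList s T = post.reverse ++ p :: pre.reverse := by
      rw [← List.reverse_reverse (pathList s T), hrev, ← hpre]; simp
    rw [subtreeKeys_eq_unseparated hT this]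
    ext b; simp [mem_unseparated]
  have hsplit : PairsSplit s (subtreeKeys T') l := by
    refine PairsSplit.mono (pathSet T s) (hlP s (by simp)) (fun a ha => ?_) l
      (fun a ha => hlP a (by simp [ha]))
      (pairsSplit_descendants s l (List.nodup_cons.1 hnd).2 hsl .nil .nil
        (by simp [keys]) (by simp [keys]))
    rw [hafter a ha, hrev]
    exact subtreeKeys_subset_descendants _
  have hmain := potential_bound hw hs (F := subtreeKeys T') (B := subtreeKeys T)
    (fun a _ => hkeys ▸ subtreeKeys_subset T')
    (fun a ha => mem_subtreeKeys_self hT' (hkeys ▸ ha))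
    (fun a b c d hb hd hc => subtreeKeys_convex hT' hb hd (hkeys ▸ hc)) l
    (fun a ha => ⟨hPK (hlP a (by simp [ha])), fun e => hsl (e ▸ ha)⟩)
    (List.pairwise_cons.1 hpw).2
    (fun p post h => hsuffix p post (h.trans (List.suffix_cons _ _))) hsplit
  have hphi : ∀ Q : BTree, phiOn w Q (pathSet T s) =
      Real.logb 2 (wsum w (subtreeKeys Q s)) +
        (l.map fun a => Real.logb 2 (wsum w (subtreeKeys Q a))).sum := by
    intro Q
    rw [phiOn, hP, List.sum_toFinset _ hnd, List.map_cons, List.sum_cons]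
  have hdiff : phiAll w T - phiAll w T' =
      phiOn w T (pathSet T s) - phiOn w T' (pathSet T s) := by
    have hrest : phiOn w T' (keys T \ pathSet T s) = phiOn w T (keys T \ pathSet T s) := by
      refine Finset.sum_congr rfl fun a ha => ?_
      obtain ⟨h1, h2⟩ := Finset.mem_sdiff.1 ha
      rw [subtreeKeys, hpend a h1 h2, ← subtreeKeys]
    have hsum : ∀ Q : BTree, phiOn w Q (keys T) =
        phiOn w Q (keys T \ pathSet T s) + phiOn w Q (pathSet T s) := fun Q =>
      (Finset.sum_sdiff hPK).symm
    rw [phiAll, phiAll, hkeys, hsum T, hsum T', hrest]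
    ring
  have hcard : ((pathSet T s).card : ℝ) = l.length + 1 := by
    rw [hP, List.toFinset_card_of_nodup hnd]; simp
  have hsT : subtreeKeys T s = unseparated (keys T) s l := hsuffix s l (List.suffix_refl _)
  have hroot := logb_wsum_mono hw (hkeys ▸ subtreeKeys_subset T' : subtreeKeys T' s ⊆ keys T)
    subset_rfl ⟨s, mem_subtreeKeys_self hT' (hkeys ▸ hs)⟩
  have hleaf := logb_wsum_mono hw
    (Finset.singleton_subset_iff.2 (mem_subtreeKeys_self hT hs)) (subtreeKeys_subset T) ⟨s, by simp⟩
  have hws : wsum w {s} = w s := by simp [wsum]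
  rw [hws, hsT] at hleaf
  rw [hdiff, hphi, hphi, hcard, hsT,
    Real.logb_div (wsum_pos hw subset_rfl ⟨s, hs⟩).ne' (hw s hs).ne']
  linarith
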